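/- arXiv:1409.4242 — 2 statements merged into one kernel-verified Lean document; each statement's English description precedes it below -/
import Mathlib

section
/- Suppose that μ(K ∖ ⋃_{j≥1} ⋃_{k≥1} GP(1/j, 1/k)) = 0. Then for every ε ∈ (0,1), μ(K ∖ ⋃_{j≥1} ⋃_{k≥1} DC(1/j, ε, 1/k)) = 0. -/
open MeasureTheory Metric Set Filter ENNReal NNReal Topology

noncomputable section

/-- A curve fragment: a `1`-Lipschitz map on a compact subset of `ℝ` that is biLipschitz
onto its image. -/
def IsFragment {X : Type*} [MetricSpace X] (γ : ℝ → X) (D : Set ℝ) : Prop :=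
  IsCompact D ∧ LipschitzOnWith 1 γ D ∧
    ∃ c : ℝ, 0 < c ∧ c ≤ 1 ∧ ∀ s ∈ D, ∀ s' ∈ D, c * |s - s'| ≤ dist (γ s) (γ s')

/-- The biLipschitz constant of a curve fragment. -/
def biLipConst {X : Type*} [MetricSpace X] (γ : ℝ → X) (D : Set ℝ) : ℝ :=
  sSup {c : ℝ | 0 < c ∧ c ≤ 1 ∧ ∀ s ∈ D, ∀ s' ∈ D, c * |s - s'| ≤ dist (γ s) (γ s')}

/-- The closed cone of width `θ` about the `j`-th standard basis direction. -/
def stdCone (n : ℕ) (j : Fin n) (θ : ℝ) : Set (EuclideanSpace ℝ (Fin n)) :=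
  {w | ‖w - w j • EuclideanSpace.single j (1 : ℝ)‖ ≤ θ * w j}

/-- The set `GP(v, R)` of points of `K` lying on suitable curve fragments in each of the `n`
coordinate directions. -/
def GP {X : Type*} [MetricSpace X] {n : ℕ} (K : Set X)
    (φ : X → EuclideanSpace ℝ (Fin n)) (v R : ℝ) : Set X :=
  {y | y ∈ K ∧ ∀ j : Fin n, ∃ (γ : ℝ → X) (D : Set ℝ) (t : ℝ),
    IsFragment γ D ∧ t ∈ D ∧ γ t = y ∧
    (∀ r' : ℝ, 0 < r' → r' < 4 * R * biLipConst γ D →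
      ENNReal.ofReal ((1 - 1 / (100000 * (n : ℝ))) * (2 * r')) <
        volume (Icc (t - r') (t + r') ∩ D ∩ γ ⁻¹' K)) ∧
    (∀ s ∈ D, ∀ s' ∈ D, s' < s →
      (φ (γ s) - φ (γ s') ∈ stdCone n j (1 / (1000 * (n : ℝ) ^ 2)) ∧
        φ (γ s) - φ (γ s') ≠ 0) ∧
      v * dist (γ s) (γ s') < ‖φ (γ s) - φ (γ s')‖)}

/-- The set `DC(β, ε, R)`, relative to a set `K` and chart `φ`. -/
def DCset {X : Type*} [MetricSpace X] {n : ℕ} (K : Set X)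
    (φ : X → EuclideanSpace ℝ (Fin n)) (β ε R : ℝ) : Set X :=
  {x | x ∈ K ∧ ∀ r : ℝ, 0 < r → r < R →
    ENNReal.ofReal (1 - ε) * μH[n] (closedBall (φ x) (β * r)) ≤
      μH[n] (closedBall (φ x) (β * r) ∩ φ '' (closedBall x r ∩ K))}

/-- The set `DP(v, ε, R)` of points around which `GP(v, R)` has high density. -/
def DP {X : Type*} [MetricSpace X] [MeasurableSpace X] {n : ℕ} (μ : Measure X) (K : Set X)
    (φ : X → EuclideanSpace ℝ (Fin n)) (v ε R : ℝ) : Set X :=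
  {x | x ∈ K ∧ ∀ r : ℝ, 0 < r → r < R →
    ENNReal.ofReal (1 - ε) * μ (closedBall x r) ≤ μ (GP K φ v R ∩ closedBall x r)}
/-- The points of `K` from which one can move inside `K`, in each coordinate direction and at every
scale `h < H`, by an amount comparable to `h`, up to a small relative error. -/
def stepSet {X : Type*} [MetricSpace X] {n : ℕ} (K : Set X)
    (φ : X → EuclideanSpace ℝ (Fin n)) (κ A H : ℝ) : Set X :=
  {y | y ∈ K ∧ ∀ (j : Fin n) (σ : ℝ), |σ| = 1 → ∀ h : ℝ, 0 < h → h < H →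
    ∃ y' ∈ K, ∃ h' : ℝ, κ * h ≤ h' ∧ h' ≤ h ∧
      ‖φ y' - φ y - (σ * h') • EuclideanSpace.single j (1 : ℝ)‖ ≤ 1 / (1000 * (n : ℝ) ^ 2) * h' ∧
      dist y y' ≤ A * h'}

lemma biLipConst_pos {X : Type*} [MetricSpace X] {γ : ℝ → X} {D : Set ℝ} (h : IsFragment γ D) :
    0 < biLipConst γ D := by
  obtain ⟨c, hc, hc1, hbi⟩ := h.2.2
  exact hc.trans_le (le_csSup ⟨1, fun x hx => hx.2.1⟩ ⟨hc, hc1, hbi⟩)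

/-- A set of nearly full measure in `[t - r, t + r]` meets both outer quarters of that interval. -/
lemma exists_mem_far_of_volume {S : Set ℝ} {t r σ : ℝ} (hσ : |σ| = 1)
    (hS : ENNReal.ofReal (3 / 2 * r) < volume (Icc (t - r) (t + r) ∩ S)) :
    ∃ s ∈ S, r / 2 ≤ σ * (s - t) ∧ σ * (s - t) ≤ r := by
  by_contra! hcon
  rcases eq_or_eq_neg_of_abs_eq hσ with rfl | rfl
  · have hsub : Icc (t - r) (t + r) ∩ S ⊆ Icc (t - r) (t + r / 2) := by
      rintro s ⟨⟨h1, h2⟩, hs⟩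
      refine ⟨h1, ?_⟩
      by_contra! h3
      linarith [hcon s hs (by linarith)]
    have := hS.trans_le (measure_mono hsub)
    rw [Real.volume_Icc] at this
    refine absurd this (not_lt.2 (ENNReal.ofReal_le_ofReal (by linarith)))
  · have hsub : Icc (t - r) (t + r) ∩ S ⊆ Icc (t - r / 2) (t + r) := by
      rintro s ⟨⟨h1, h2⟩, hs⟩
      refine ⟨?_, h2⟩
      by_contra! h3
      linarith [hcon s hs (by linarith)]
    have := hS.trans_le (measure_mono hsub)
    rw [Real.volume_Icc] at this
    refine absurd this (not_lt.2 (ENNReal.ofReal_le_ofReal (by linarith)))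

/-- A vector of the cone about `e_j` has norm at most twice its `j`-th coordinate. -/
lemma norm_le_two_mul_of_mem_stdCone {n : ℕ} {j : Fin n} {θ : ℝ} (hθ : θ ≤ 1)
    {w : EuclideanSpace ℝ (Fin n)} (hw : w ∈ stdCone n j θ) (hw0 : w ≠ 0) (hθ0 : 0 < θ) :
    0 < w j ∧ ‖w‖ ≤ 2 * w j := by
  have hw : ‖w - w j • EuclideanSpace.single j (1 : ℝ)‖ ≤ θ * w j := hw
  have hj : 0 ≤ w j := by
    have := (norm_nonneg _).trans hw
    exact nonneg_of_mul_nonneg_right this hθ0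
  have h1 : ‖w‖ ≤ ‖w - w j • EuclideanSpace.single j (1 : ℝ)‖ +
      ‖w j • EuclideanSpace.single j (1 : ℝ)‖ := by
    simpa using norm_add_le (w - w j • EuclideanSpace.single j (1 : ℝ))
      (w j • EuclideanSpace.single j (1 : ℝ))
  have h2 : ‖w j • EuclideanSpace.single j (1 : ℝ)‖ = w j := by
    simp [norm_smul, abs_of_nonneg hj]
  have h3 : ‖w‖ ≤ 2 * w j := by nlinarith
  have h4 : 0 < ‖w‖ := norm_pos_iff.2 hw0
  exact ⟨by linarith, h3⟩

lemma exists_step_of_mem_GP {X : Type*} [MetricSpace X] {n : ℕ} {K : Set X}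
    {φ : X → EuclideanSpace ℝ (Fin n)} (hφ : LipschitzWith 1 φ) {v R : ℝ} (hv : 0 < v)
    (hR : 0 < R) {y : X} (hy : y ∈ GP K φ v R) (j : Fin n) :
    ∃ κ H : ℝ, 0 < κ ∧ 0 < H ∧ ∀ σ : ℝ, |σ| = 1 → ∀ h : ℝ, 0 < h → h < H →
      ∃ y' ∈ K, ∃ h' : ℝ, κ * h ≤ h' ∧ h' ≤ h ∧
        ‖φ y' - φ y - (σ * h') • EuclideanSpace.single j (1 : ℝ)‖ ≤
          1 / (1000 * (n : ℝ) ^ 2) * h' ∧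
        dist y y' ≤ 2 / v * h' := by
  obtain ⟨γ, D, t, hγ, htD, rfl, hdens, hcone⟩ := hy.2 j
  obtain ⟨c, hc, hc1, hbi⟩ := hγ.2.2
  have hn : (1 : ℝ) ≤ n := by
    have : 0 < n := j.pos
    exact_mod_cast this
  have hn2 : (1 : ℝ) ≤ (n : ℝ) ^ 2 := one_le_pow₀ hn
  set θ : ℝ := 1 / (1000 * (n : ℝ) ^ 2) with hθ
  have hθ0 : 0 < θ := by positivity
  have hθ1 : θ ≤ 1 := by
    rw [hθ, div_le_one (by positivity)]
    linarith
  have key : ∀ s ∈ D, ∀ s' ∈ D, s' < s → ∀ r, r / 2 ≤ s - s' → s - s' ≤ r →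
      v * c / 4 * r ≤ (φ (γ s) - φ (γ s')) j ∧ (φ (γ s) - φ (γ s')) j ≤ r ∧
        dist (γ s) (γ s') ≤ 2 / v * (φ (γ s) - φ (γ s')) j := by
    intro s hs s' hs' hlt r hr1 hr2
    obtain ⟨⟨hw, hw0⟩, hspeed⟩ := hcone s hs s' hs' hlt
    obtain ⟨hwj, hwn⟩ := norm_le_two_mul_of_mem_stdCone hθ1 hw hw0 hθ0
    set w := φ (γ s) - φ (γ s')
    have h1 := hbi s hs s' hs'
    rw [abs_of_pos (sub_pos.2 hlt)] at h1
    have h2 : w j ≤ ‖w‖ := (le_abs_self _).trans (PiLp.norm_apply_le w j)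
    have h3 : ‖w‖ ≤ dist (γ s) (γ s') := by
      rw [← dist_eq_norm]
      simpa using hφ.dist_le_mul (γ s) (γ s')
    have h4 : dist (γ s) (γ s') ≤ s - s' := by
      have := hγ.2.1.dist_le_mul s hs s' hs'
      rwa [Real.dist_eq, abs_of_pos (sub_pos.2 hlt), NNReal.coe_one, one_mul] at this
    refine ⟨?_, by linarith, ?_⟩
    · have : v * (c * (r / 2)) ≤ v * dist (γ s) (γ s') :=
        mul_le_mul_of_nonneg_left ((mul_le_mul_of_nonneg_left hr1 hc.le).trans h1) hv.le
      nlinarith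
    · rw [div_mul_eq_mul_div, le_div_iff₀ hv]
      linarith
  refine ⟨v * c / 4, 4 * R * biLipConst γ D, by positivity,
    mul_pos (by positivity) (biLipConst_pos hγ), fun σ hσ h h0 hh => ?_⟩
  have hvol : ENNReal.ofReal (3 / 2 * h) <
      volume (Icc (t - h) (t + h) ∩ (D ∩ γ ⁻¹' K)) := by
    rw [← inter_assoc]
    refine lt_of_le_of_lt (ENNReal.ofReal_le_ofReal ?_) (hdens h h0 hh)
    have : 1 / (100000 * (n : ℝ)) ≤ 1 / 4 :=
      one_div_le_one_div_of_le (by norm_num) (by linarith)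
    nlinarith
  obtain ⟨s, ⟨hsD, hsK⟩, hs1, hs2⟩ := exists_mem_far_of_volume hσ hvol
  refine ⟨γ s, hsK, ?_⟩
  rcases eq_or_eq_neg_of_abs_eq hσ with rfl | rfl
  · obtain ⟨k1, k2, k3⟩ := key s hsD t htD (by linarith) h (by linarith) (by linarith)
    refine ⟨_, k1, k2, ?_, by rwa [dist_comm]⟩
    rw [one_mul]
    exact (hcone s hsD t htD (by linarith)).1.1
  · obtain ⟨k1, k2, k3⟩ := key t htD s hsD (by linarith) h (by linarith) (by linarith)
    refine ⟨_, k1, k2, ?_, k3⟩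
    have h5 : ‖(φ (γ t) - φ (γ s)) - (φ (γ t) - φ (γ s)) j • EuclideanSpace.single j (1 : ℝ)‖ ≤
      θ * (φ (γ t) - φ (γ s)) j := (hcone t htD s hsD (by linarith)).1.1
    rw [← norm_neg] at h5
    refine le_of_eq_of_le (congrArg norm ?_) h5
    module

lemma GP_subset_iUnion_stepSet {X : Type*} [MetricSpace X] {n : ℕ} {K : Set X}
    {φ : X → EuclideanSpace ℝ (Fin n)} (hφ : LipschitzWith 1 φ) {v R : ℝ} (hv : 0 < v)
    (hR : 0 < R) :
    GP K φ v R ⊆ ⋃ m : ℕ, stepSet K φ (1 / ((m : ℝ) + 1)) (m + 1) (1 / ((m : ℝ) + 1)) := by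
  intro y hy
  choose κ H hκ hH hstep using exists_step_of_mem_GP hφ hv hR hy
  have hsmall : ∀ a : ℝ, 0 < a → ∀ᶠ m : ℕ in atTop, 1 / ((m : ℝ) + 1) ≤ a := fun a ha =>
    tendsto_one_div_add_atTop_nhds_zero_nat.eventually_le_const ha
  obtain ⟨m, hmκ, hmH, hmA⟩ := ((eventually_all.2 fun j => hsmall (κ j) (hκ j)).and
    ((eventually_all.2 fun j => hsmall (H j) (hH j)).and (hsmall (v / 2) (by positivity)))).exists
  have hA : 2 / v ≤ (m : ℝ) + 1 := by
    rw [div_le_div_iff₀ (by positivity) (by norm_num)] at hmA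
    rw [div_le_iff₀ hv]
    linarith
  refine mem_iUnion.2 ⟨m, hy.1, fun j σ hσ h h0 hh => ?_⟩
  obtain ⟨y', hy', h', h1, h2, h3, h4⟩ := hstep j σ hσ h h0 (hh.trans_le (hmH j))
  have hκh := mul_le_mul_of_nonneg_right (hmκ j) h0.le
  have h'0 : 0 ≤ h' := (mul_nonneg (by positivity) h0.le).trans (hκh.trans h1)
  exact ⟨y', hy', h', hκh.trans h1, h2, h3, h4.trans (mul_le_mul_of_nonneg_right hA h'0)⟩

/-- Some coordinate of `u` has absolute value at least `‖u‖ / √n`. -/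
lemma exists_coord_sq_ge {n : ℕ} (u : EuclideanSpace ℝ (Fin n)) (hu : u ≠ 0) :
    ∃ j, ‖u‖ ^ 2 ≤ n * u j ^ 2 := by
  have hne : (Finset.univ : Finset (Fin n)).Nonempty := by
    by_contra h
    refine hu (PiLp.ext fun i => ?_)
    exact (h ⟨i, Finset.mem_univ i⟩).elim
  obtain ⟨j, -, hj⟩ := Finset.exists_max_image Finset.univ (fun i => u i ^ 2) hne
  refine ⟨j, ?_⟩
  rw [EuclideanSpace.real_norm_sq_eq]
  simpa using Finset.sum_le_card_nsmul Finset.univ (fun i => u i ^ 2) (u j ^ 2) hj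

/-- Subtracting from `u` a part of its largest coordinate, up to a small relative error,
decreases its norm. -/
lemma norm_sub_le_of_step {n : ℕ} {u e : EuclideanSpace ℝ (Fin n)} {j : Fin n} {κ σ h' : ℝ}
    (hj : ‖u‖ ^ 2 ≤ n * u j ^ 2) (hu : u ≠ 0) (hκ : 0 < κ) (hσ : σ * |u j| = u j)
    (hσ1 : |σ| = 1) (h1 : κ * |u j| ≤ h') (h2 : h' ≤ |u j|)
    (he : ‖e‖ ≤ 1 / (1000 * (n : ℝ) ^ 2) * h') :
    ‖u - (σ * h') • EuclideanSpace.single j (1 : ℝ) - e‖ ≤ (1 - κ / (4 * n)) * ‖u‖ := by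
  have hn : (1 : ℝ) ≤ n := by
    have : 0 < n := j.pos
    exact_mod_cast this
  have hN : 0 < ‖u‖ := norm_pos_iff.2 hu
  have hσsq : σ ^ 2 = 1 := by rw [← sq_abs, hσ1, one_pow]
  set a := |u j| with ha
  have ha2 : u j ^ 2 = a ^ 2 := (sq_abs _).symm
  rw [ha2] at hj
  have haN : a ≤ ‖u‖ := PiLp.norm_apply_le u j
  have ha0 : 0 < a := by
    rcases (abs_nonneg (u j)).lt_or_eq with h | h
    · exact h
    · rw [ha, ← h] at hj
      nlinarith
  have hh0 : 0 < h' := (mul_pos hκ ha0).trans_le h1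
  have hNn : ‖u‖ ≤ n * a := by
    refine le_of_sq_le_sq ?_ (by positivity)
    nlinarith [sq_nonneg a]
  have hsq : ‖u - (σ * h') • EuclideanSpace.single j (1 : ℝ)‖ ^ 2 ≤ ‖u‖ ^ 2 - h' * a := by
    rw [norm_sub_sq_real, inner_smul_right, EuclideanSpace.inner_single_right, norm_smul]
    simp only [PiLp.norm_single, norm_one, mul_one, Real.norm_eq_abs, sq_abs, mul_pow,
      hσsq, one_mul, conj_trivial]
    have : σ * h' * u j = h' * a := by
      rw [← hσ]
      linear_combination h' * a * hσsq
    rw [this]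
    nlinarith
  have hle : ‖u - (σ * h') • EuclideanSpace.single j (1 : ℝ)‖ ≤ ‖u‖ - h' * a / (2 * ‖u‖) := by
    have hq : h' * a / (2 * ‖u‖) ≤ ‖u‖ := by
      rw [div_le_iff₀ (by positivity)]
      nlinarith
    refine le_of_sq_le_sq (hsq.trans ?_) (sub_nonneg.2 hq)
    have : 2 * ‖u‖ * (h' * a / (2 * ‖u‖)) = h' * a := by field_simp
    nlinarith [sq_nonneg (h' * a / (2 * ‖u‖))]
  have herr : ‖e‖ ≤ h' * a / (4 * ‖u‖) := by
    refine he.trans ?_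
    rw [one_div, inv_mul_eq_div, div_le_div_iff₀ (by positivity) (by positivity)]
    have : 4 * ‖u‖ ≤ a * (1000 * (n : ℝ) ^ 2) := by nlinarith [mul_pos ha0 (by linarith : (0:ℝ) < n)]
    nlinarith
  have hgain : κ / (4 * n) * ‖u‖ ≤ h' * a / (4 * ‖u‖) := by
    rw [div_mul_eq_mul_div, div_le_div_iff₀ (by positivity) (by positivity)]
    have h3 : κ * a * a ≤ h' * a := mul_le_mul_of_nonneg_right h1 ha0.le
    have h4 : κ * ‖u‖ ^ 2 ≤ κ * (n * a ^ 2) := mul_le_mul_of_nonneg_left hj hκ.le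
    nlinarith
  have hsplit : h' * a / (2 * ‖u‖) = h' * a / (4 * ‖u‖) + h' * a / (4 * ‖u‖) := by
    field_simp
    norm_num
  calc _ ≤ ‖u - (σ * h') • EuclideanSpace.single j (1 : ℝ)‖ + ‖e‖ := norm_sub_le _ _
    _ ≤ (1 - κ / (4 * n)) * ‖u‖ := by linarith

/-- If some point of the step set is close to `y`, then one can move from `y` to another point of
`K` whose image is closer to `z` by a definite factor. -/
lemma exists_closer_of_stepSet {X : Type*} [MetricSpace X] {n : ℕ} {K : Set X}
    {φ : X → EuclideanSpace ℝ (Fin n)} (hφ : LipschitzWith 1 φ) {κ A H δ : ℝ} (hκ : 0 < κ)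
    (hA : 0 ≤ A) (hδ : 0 < δ) (hδκ : δ * (8 * (n + 1)) = κ) (hδ1 : δ < 1)
    {y y' : X} {z : EuclideanSpace ℝ (Fin n)} (hd : 0 < dist z (φ y))
    (hdH : 2 * dist z (φ y) < H) (hy' : y' ∈ stepSet K φ κ A H)
    (hyy' : dist y y' ≤ δ * dist z (φ y)) :
    ∃ y'' ∈ K, dist z (φ y'') ≤ (1 - δ) * dist z (φ y) ∧
      dist y y'' ≤ (1 + 2 * A) * dist z (φ y) := by
  set d := dist z (φ y)
  have hφy : dist (φ y) (φ y') ≤ δ * d := by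
    have := hφ.dist_le_mul y y'
    rw [NNReal.coe_one, one_mul] at this
    exact this.trans hyy'
  set u := z - φ y' with hu_def
  have hnu : ‖u‖ = dist z (φ y') := (dist_eq_norm _ _).symm
  have hu1 : ‖u‖ ≤ (1 + δ) * d := by
    rw [hnu]
    linarith [dist_triangle z (φ y) (φ y')]
  have hu2 : (1 - δ) * d ≤ ‖u‖ := by
    rw [hnu]
    linarith [dist_triangle_right z (φ y) (φ y')]
  have hu0 : u ≠ 0 := norm_pos_iff.1 ((mul_pos (by linarith) hd).trans_le hu2)
  obtain ⟨j, hj⟩ := exists_coord_sq_ge u hu0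
  have hn : (1 : ℝ) ≤ n := by
    have : 0 < n := j.pos
    exact_mod_cast this
  have huj : u j ≠ 0 := by
    intro h0
    rw [h0] at hj
    have := norm_pos_iff.2 hu0
    nlinarith
  have hle : |u j| ≤ ‖u‖ := PiLp.norm_apply_le u j
  have hu2d : ‖u‖ ≤ 2 * d := by nlinarith
  obtain ⟨σ, hσ1, hσ⟩ : ∃ σ : ℝ, |σ| = 1 ∧ σ * |u j| = u j := by
    rcases huj.lt_or_gt with h | h
    · exact ⟨-1, by simp, by rw [abs_of_neg h]; ring⟩
    · exact ⟨1, by simp, by rw [abs_of_pos h]; ring⟩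
  obtain ⟨y'', hy'', h', h1, h2, h3, h4⟩ :=
    hy'.2 j σ hσ1 |u j| (abs_pos.2 huj) (by linarith)
  refine ⟨y'', hy'', ?_, ?_⟩
  · have hstep := norm_sub_le_of_step hj hu0 hκ hσ hσ1 h1 h2 h3
    have heq : u - (σ * h') • EuclideanSpace.single j (1 : ℝ) -
        (φ y'' - φ y' - (σ * h') • EuclideanSpace.single j (1 : ℝ)) = z - φ y'' := by
      rw [hu_def]
      abel
    rw [heq, ← dist_eq_norm] at hstep
    have hκn : 2 * δ ≤ κ / (4 * n) := by
      rw [le_div_iff₀ (by positivity), ← hδκ]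
      nlinarith
    have : (1 - κ / (4 * n)) * ‖u‖ ≤ (1 - 2 * δ) * ‖u‖ :=
      mul_le_mul_of_nonneg_right (by linarith) (norm_nonneg _)
    by_cases h2δ : 2 * δ ≤ 1
    · have : (1 - 2 * δ) * ‖u‖ ≤ (1 - 2 * δ) * ((1 + δ) * d) :=
        mul_le_mul_of_nonneg_left hu1 (by linarith)
      nlinarith [mul_pos (mul_pos hδ hδ) hd]
    · have : (1 - 2 * δ) * ‖u‖ ≤ 0 := mul_nonpos_of_nonpos_of_nonneg (by linarith) (norm_nonneg _)
      nlinarith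
  · have h5 : A * h' ≤ A * (2 * d) := mul_le_mul_of_nonneg_left (by linarith) hA
    have h6 : δ * d ≤ d := by nlinarith
    linarith [dist_triangle y y' y'']

/-- A point of a small ball about `φ x` missed by the image of `K ∩ B(x, r)` comes with a ball,
of comparable radius and centred in `K`, that contains no point of the step set. -/
lemma exists_ball_disjoint_stepSet {X : Type*} [MetricSpace X] {n : ℕ} {K : Set X}
    (hK : IsCompact K) {φ : X → EuclideanSpace ℝ (Fin n)} (hφ : LipschitzWith 1 φ)
    {κ A H δ β r : ℝ} (hκ : 0 < κ)
    (hA : 0 ≤ A) (hδ : 0 < δ) (hδκ : δ * (8 * (n + 1)) = κ) (hδ1 : δ < 1)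
    (hβ : (2 + 2 * A) * β ≤ δ) (hr : 0 < r) (hβr : 2 * (β * r) < H)
    {x : X} (hx : x ∈ K) {z : EuclideanSpace ℝ (Fin n)} (hz : z ∈ closedBall (φ x) (β * r))
    (hzK : z ∉ φ '' (closedBall x r ∩ K)) :
    ∃ y ∈ K, dist y x ≤ r ∧ 0 < dist z (φ y) ∧ dist z (φ y) ≤ β * r ∧
      Disjoint (closedBall y (δ * dist z (φ y))) (stepSet K φ κ A H) := by
  set L := (2 + 2 * A) / δ with hL
  have hL0 : 0 < L := by positivity
  have hLδ : L * δ = 2 + 2 * A := div_mul_cancel₀ _ hδ.ne'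
  have hLβ : L * β ≤ 1 := by
    rw [hL, div_mul_eq_mul_div, div_le_one hδ]
    exact hβ
  obtain ⟨y, hyK, hmin⟩ := hK.exists_isMinOn ⟨x, hx⟩
    (f := fun y => dist x y + L * dist z (φ y)) (by
      have := hφ.continuous
      fun_prop)
  have hmin : ∀ y' ∈ K, dist x y + L * dist z (φ y) ≤ dist x y' + L * dist z (φ y') :=
    fun y' hy' => hmin hy'
  have hxy := hmin x hx
  rw [dist_self, zero_add] at hxy
  have hz : dist z (φ x) ≤ β * r := hz
  have hdr : dist y x ≤ r := by
    rw [dist_comm]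
    have h1 : 0 ≤ L * dist z (φ y) := by positivity
    have h2 : L * dist z (φ x) ≤ L * (β * r) := mul_le_mul_of_nonneg_left hz hL0.le
    nlinarith
  have hdz : dist z (φ y) ≤ dist z (φ x) :=
    le_of_mul_le_mul_left (by linarith [dist_nonneg (x := x) (y := y)]) hL0
  have hd0 : 0 < dist z (φ y) := dist_pos.2 fun h => hzK ⟨y, ⟨hdr, hyK⟩, h.symm⟩
  refine ⟨y, hyK, hdr, hd0, hdz.trans hz, ?_⟩
  rw [Set.disjoint_left]
  intro y' hy'1 hy'2
  rw [mem_closedBall, dist_comm] at hy'1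
  obtain ⟨y'', hy''K, h1, h2⟩ :=
    exists_closer_of_stepSet hφ hκ hA hδ hδκ hδ1 hd0 (by linarith) hy'2 hy'1
  have h3 := hmin y'' hy''K
  have h4 := mul_le_mul_of_nonneg_left h1 hL0.le
  have h5 := dist_triangle x y y''
  have h6 : L * ((1 - δ) * dist z (φ y)) =
    L * dist z (φ y) - (2 + 2 * A) * dist z (φ y) := by rw [← hLδ]; ring
  linarith

/-- Almost every point of a set `G ⊆ K` is a density point of `G`, where `μ` is Ahlfors regular at
the points of `K` at small scales. -/
lemma measure_nonDensityPoints_eq_zero {X : Type*} [MetricSpace X]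
    [TopologicalSpace.SeparableSpace X] [MeasurableSpace X] [BorelSpace X]
    {n : ℕ} {μ : Measure X} [IsFiniteMeasure μ] {K : Set X} {C RK : ℝ} (hC : 0 < C)
    (hRK : 0 < RK)
    (hgrowth : ∀ x ∈ K, ∀ r : ℝ, 0 < r → r < RK →
      ENNReal.ofReal (C⁻¹ * r ^ n) ≤ μ (closedBall x r) ∧
        μ (closedBall x r) ≤ ENNReal.ofReal (C * r ^ n))
    {G : Set X} (hG : G ⊆ K) {η : ℝ} (hη : 0 < η) :
    μ {x ∈ G | ∀ ρ : ℝ, 0 < ρ → ∃ r, 0 < r ∧ r < ρ ∧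
      μ (G ∩ closedBall x r) + ENNReal.ofReal η * μ (closedBall x r) < μ (closedBall x r)} = 0 := by
  have : SecondCountableTopology X := UniformSpace.secondCountable_of_separable X
  set A := {x ∈ G | ∀ ρ : ℝ, 0 < ρ → ∃ r, 0 < r ∧ r < ρ ∧
    μ (G ∩ closedBall x r) + ENNReal.ofReal η * μ (closedBall x r) < μ (closedBall x r)}
  set Gm := toMeasurable μ G
  have hGm : MeasurableSet Gm := measurableSet_toMeasurable μ G
  have hAG : A ⊆ Gm := (sep_subset _ _).trans (subset_toMeasurable μ G)
  have hη0 : ENNReal.ofReal η ≠ 0 := (ENNReal.ofReal_pos.2 hη).ne'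
  suffices h : ∀ e : ℝ≥0, 0 < e → ENNReal.ofReal η * μ A ≤ e by
    have h0 : ENNReal.ofReal η * μ A ≤ 0 :=
      ENNReal.le_of_forall_pos_le_add fun e he _ => by simpa using h e he
    exact (mul_eq_zero.1 (le_antisymm h0 zero_le)).resolve_left hη0
  intro e he
  obtain ⟨U, hAU, hUo, hUe⟩ := A.exists_isOpen_le_add μ (ENNReal.coe_pos.2 he).ne'
  obtain ⟨u, hut, huc, hud, hucov⟩ := Vitali.exists_disjoint_covering_ae μ A
    {p : X × ℝ | p.1 ∈ A ∧ 0 < p.2 ∧ 3 * p.2 < RK ∧ closedBall p.1 p.2 ⊆ U ∧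
      μ (G ∩ closedBall p.1 p.2) + ENNReal.ofReal η * μ (closedBall p.1 p.2) <
        μ (closedBall p.1 p.2)}
    (Real.toNNReal (C ^ 2 * 3 ^ n)) (fun p => p.2) (fun p => p.1)
    (fun p => closedBall p.1 p.2) (fun p _ => Subset.rfl)
    (by
      rintro ⟨x, r⟩ ⟨hxA, hr, hrK, -, -⟩
      have hxK := hG hxA.1
      calc μ (closedBall x (3 * r)) ≤ ENNReal.ofReal (C * (3 * r) ^ n) :=
            (hgrowth x hxK _ (by linarith) hrK).2
        _ = ENNReal.ofReal (C ^ 2 * 3 ^ n) * ENNReal.ofReal (C⁻¹ * r ^ n) := by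
            rw [← ENNReal.ofReal_mul (by positivity)]
            congr 1
            rw [mul_pow]
            field_simp
        _ ≤ _ := mul_le_mul_right (hgrowth x hxK r hr (by linarith)).1 _)
    (fun p hp => ⟨p.1, ball_subset_interior_closedBall (mem_ball_self hp.2.1)⟩)
    (fun p _ => isClosed_closedBall)
    (by
      intro x hx ε hε
      obtain ⟨ρ, hρ, hρU⟩ := Metric.isOpen_iff.1 hUo x (hAU hx)
      obtain ⟨r, hr, hrlt, hbad⟩ := hx.2 (min ε (min ρ (RK / 3))) (by positivity)
      rw [lt_min_iff, lt_min_iff] at hrlt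
      exact ⟨(x, r), ⟨hx, hr, by linarith [hrlt.2.2],
        (closedBall_subset_ball hrlt.2.1).trans hρU, hbad⟩, hrlt.1.le, rfl⟩)
  have hout : ∀ p ∈ u, ENNReal.ofReal η * μ (closedBall p.1 p.2) ≤
      μ (closedBall p.1 p.2 \ Gm) := by
    intro p hp
    obtain ⟨-, -, -, -, hbad⟩ := hut hp
    rw [← Measure.measure_toMeasurable_inter isClosed_closedBall.measurableSet (measure_ne_top μ G)]
      at hbad
    have hsplit := measure_inter_add_sdiff (μ := μ) (closedBall p.1 p.2) hGm
    rw [inter_comm] at hsplit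
    rw [← hsplit] at hbad
    rw [← hsplit]
    exact (lt_of_add_lt_add_left hbad).le
  have hUdiff : μ (U \ Gm) ≤ e := by
    have h1 : μ A + μ (U \ Gm) ≤ μ A + e := by
      calc μ A + μ (U \ Gm) ≤ μ (U ∩ Gm) + μ (U \ Gm) := by
            gcongr
            exact subset_inter hAU hAG
        _ = μ U := measure_inter_add_sdiff U hGm
        _ ≤ μ A + e := hUe
    exact (ENNReal.add_le_add_iff_left (measure_ne_top μ A)).1 h1
  have hAle : μ A ≤ ∑' p : u, μ (closedBall p.1.1 p.1.2) := by
    calc μ A ≤ μ (A \ ⋃ p ∈ u, closedBall p.1 p.2) + μ (⋃ p ∈ u, closedBall p.1 p.2) :=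
          (measure_mono (by rw [sdiff_union_self]; exact subset_union_left)).trans
            (measure_union_le _ _)
      _ = μ (⋃ p ∈ u, closedBall p.1 p.2) := by rw [hucov, zero_add]
      _ ≤ _ := measure_biUnion_le μ huc _
  calc ENNReal.ofReal η * μ A
      ≤ ENNReal.ofReal η * ∑' p : u, μ (closedBall p.1.1 p.1.2) := by gcongr
    _ = ∑' p : u, ENNReal.ofReal η * μ (closedBall p.1.1 p.1.2) := ENNReal.tsum_mul_left.symm
    _ ≤ ∑' p : u, μ (closedBall p.1.1 p.1.2 \ Gm) := ENNReal.tsum_le_tsum fun p => hout p p.2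
    _ = μ (⋃ p ∈ u, closedBall p.1 p.2 \ Gm) :=
        (measure_biUnion huc (hud.mono fun _ => sdiff_subset)
          fun p _ => isClosed_closedBall.measurableSet.diff hGm).symm
    _ ≤ μ (U \ Gm) := measure_mono (iUnion₂_subset fun p hp =>
        sdiff_subset_sdiff_left (hut hp).2.2.2.1)
    _ ≤ e := hUdiff

/-- The Hausdorff measure of a closed ball in Euclidean space. -/
lemma hausdorffMeasure_closedBall {n : ℕ} (z : EuclideanSpace ℝ (Fin n)) {r : ℝ} (hr : 0 ≤ r) :
    μH[n] (closedBall z r) =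
      ENNReal.ofReal (r ^ n) * μH[n] (closedBall (0 : EuclideanSpace ℝ (Fin n)) 1) := by
  have h := Measure.addHaar_closedBall'
    (μH[Module.finrank ℝ (EuclideanSpace ℝ (Fin n))] : Measure (EuclideanSpace ℝ (Fin n))) z hr
  rwa [finrank_euclideanSpace_fin] at h

lemma hausdorffMeasure_closedBall_ne_top {n : ℕ} (z : EuclideanSpace ℝ (Fin n)) (r : ℝ) :
    μH[n] (closedBall z r) ≠ ∞ := by
  have h := (isCompact_closedBall z r).measure_ne_top
    (μ := (μH[Module.finrank ℝ (EuclideanSpace ℝ (Fin n))] : Measure (EuclideanSpace ℝ (Fin n))))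
  rwa [finrank_euclideanSpace_fin] at h

/-- A set `S` in Euclidean space has small Hausdorff measure if each of its points `z` comes with a
ball of `X`, of radius comparable to the distance from `z` to the image of its centre, that avoids a
set `G` of high density. -/
lemma hausdorffMeasure_le_of_disjoint_closedBall {X : Type*} [MetricSpace X] [MeasurableSpace X]
    [BorelSpace X] {n : ℕ} {μ : Measure X} [IsFiniteMeasure μ] {K : Set X}
    {C RK : ℝ} (hC : 0 < C)
    (hgrowth : ∀ x ∈ K, ∀ r : ℝ, 0 < r → r < RK →
      ENNReal.ofReal (C⁻¹ * r ^ n) ≤ μ (closedBall x r) ∧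
        μ (closedBall x r) ≤ ENNReal.ofReal (C * r ^ n))
    {φ : X → EuclideanSpace ℝ (Fin n)} (hφ : LipschitzWith 1 φ) {δ β r ε η : ℝ}
    (hδ : 0 < δ) (hδ1 : δ < 1) (hβ0 : 0 < β) (hβ1 : β ≤ 1) (hr : 0 < r)
    (hrK : 2 * r < RK) (hη : 0 ≤ η) (hηε : 10 ^ n * C ^ 2 * η ≤ ε * (δ * β) ^ n)
    {x : X} (hx : x ∈ K) {G : Set X}
    (hdens : μ (closedBall x (2 * r)) ≤ μ (G ∩ closedBall x (2 * r)) +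
      ENNReal.ofReal η * μ (closedBall x (2 * r)))
    {S : Set (EuclideanSpace ℝ (Fin n))}
    (hS : ∀ z ∈ S, ∃ y ∈ K, dist y x ≤ r ∧ 0 < dist z (φ y) ∧
      dist z (φ y) ≤ β * r ∧ Disjoint (closedBall y (δ * dist z (φ y))) G) :
    μH[n] S ≤ ENNReal.ofReal ε * μH[n] (closedBall (φ x) (β * r)) := by
  have hhole : ∀ z, ∃ y : X, z ∈ S → y ∈ K ∧ dist y x ≤ r ∧ 0 < dist z (φ y) ∧
      dist z (φ y) ≤ β * r ∧ Disjoint (closedBall y (δ * dist z (φ y))) G := by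
    intro z
    by_cases hz : z ∈ S
    · obtain ⟨y, hy⟩ := hS z hz
      exact ⟨y, fun _ => hy⟩
    · exact ⟨x, fun h => (hz h).elim⟩
  choose y hy using hhole
  set d : EuclideanSpace ℝ (Fin n) → ℝ := fun z => dist z (φ (y z))
  obtain ⟨u, huS, hud, hucov⟩ := Vitali.exists_disjoint_subfamily_covering_enlargement_closedBall
    S (fun z => φ (y z)) d (β * r) (fun z hz => (hy z hz).2.2.2.1) 5 (by norm_num)
  have huc : u.Countable := hud.countable_of_nonempty_interior fun z hz =>
    ⟨φ (y z), ball_subset_interior_closedBall (mem_ball_self (hy z (huS hz)).2.2.1)⟩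
  have hdr : ∀ z ∈ u, δ * d z ≤ r := fun z hz => by
    have h1 := (hy z (huS hz)).2.2.2.1
    have h2 := (hy z (huS hz)).2.2.1
    have h3 : β * r ≤ r := by nlinarith
    have h4 : δ * d z ≤ d z := by nlinarith
    exact h4.trans (h1.trans h3)
  set W := μH[n] (closedBall (0 : EuclideanSpace ℝ (Fin n)) 1)
  -- the holes are covered by the enlarged balls
  have hcover : μH[n] S ≤ ∑' z : u, ENNReal.ofReal ((5 * d z) ^ n) * W := by
    calc μH[n] S ≤ μH[n] (⋃ z ∈ u, closedBall (φ (y z)) (5 * d z)) := by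
          refine measure_mono fun z hz => ?_
          obtain ⟨b, hb, hzb⟩ := hucov z hz
          exact mem_iUnion₂.2 ⟨b, hb, hzb (mem_closedBall.2 le_rfl)⟩
      _ ≤ ∑' z : u, μH[n] (closedBall (φ (y z)) (5 * d z)) := measure_biUnion_le _ huc _
      _ = _ := tsum_congr fun z =>
          hausdorffMeasure_closedBall _ (mul_nonneg (by norm_num) dist_nonneg)
  -- the small balls around their centres are disjoint and avoid the step set
  have hdisj : u.PairwiseDisjoint fun z => closedBall (y z) (δ * d z) := by
    intro a ha b hb hab
    refine Set.disjoint_left.2 fun w hwa hwb =>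
      Set.disjoint_left.1 (hud ha hb hab) (show φ w ∈ _ from ?_) ?_
    · have h1 := hφ.dist_le_mul w (y a)
      rw [NNReal.coe_one, one_mul] at h1
      have h2 : δ * d a ≤ d a := mul_le_of_le_one_left dist_nonneg hδ1.le
      exact h1.trans (le_trans hwa h2)
    · have h1 := hφ.dist_le_mul w (y b)
      rw [NNReal.coe_one, one_mul] at h1
      have h2 : δ * d b ≤ d b := mul_le_of_le_one_left dist_nonneg hδ1.le
      exact h1.trans (le_trans hwb h2)
  set V := ⋃ z ∈ u, closedBall (y z) (δ * d z) with hV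
  have hVm : MeasurableSet V :=
    MeasurableSet.biUnion huc fun z _ => isClosed_closedBall.measurableSet
  have hVlow : ∑' z : u, ENNReal.ofReal (C⁻¹ * (δ * d z) ^ n) ≤ μ V := by
    rw [hV, measure_biUnion huc hdisj fun z _ => isClosed_closedBall.measurableSet]
    refine ENNReal.tsum_le_tsum fun z => ?_
    have h := hy z (huS z.2)
    exact (hgrowth _ h.1 _ (mul_pos hδ h.2.2.1) (by linarith [hdr z z.2])).1
  have hVB : V ⊆ closedBall x (2 * r) := iUnion₂_subset fun z hz =>
    closedBall_subset_closedBall' (by linarith [hdr z hz, (hy z (huS hz)).2.1])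
  have hVG : Disjoint V G := by
    rw [hV]
    simp only [Set.disjoint_iUnion_left]
    exact fun z hz => (hy z (huS hz)).2.2.2.2
  have hVup : μ V ≤ ENNReal.ofReal η * μ (closedBall x (2 * r)) := by
    have h1 : μ V + μ (G ∩ closedBall x (2 * r)) ≤ μ (closedBall x (2 * r)) := by
      rw [← measure_inter_add_sdiff (closedBall x (2 * r)) hVm, inter_eq_right.2 hVB]
      gcongr
      exact fun w hw => ⟨hw.2, fun hwV => Set.disjoint_left.1 hVG hwV hw.1⟩
    have h2 := h1.trans hdens
    rw [add_comm] at h2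
    exact (ENNReal.add_le_add_iff_left (measure_ne_top μ _)).1 h2
  have hVup' : μ V ≤ ENNReal.ofReal (η * (C * (2 * r) ^ n)) := by
    rw [ENNReal.ofReal_mul hη]
    exact hVup.trans (mul_le_mul_right (hgrowth x hx _ (by linarith) hrK).2 _)
  have hcoef : ∀ z, ENNReal.ofReal ((5 * d z) ^ n) * W =
      (ENNReal.ofReal (C * (5 / δ) ^ n) * W) * ENNReal.ofReal (C⁻¹ * (δ * d z) ^ n) := by
    intro z
    rw [mul_right_comm, ← ENNReal.ofReal_mul (by positivity)]
    congr 2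
    rw [div_pow, mul_pow, mul_pow]
    field_simp
  calc μH[n] S ≤ (ENNReal.ofReal (C * (5 / δ) ^ n) * W) *
        ∑' z : u, ENNReal.ofReal (C⁻¹ * (δ * d z) ^ n) := by
        rw [← ENNReal.tsum_mul_left]
        exact hcover.trans_eq (tsum_congr fun z => hcoef z)
    _ ≤ (ENNReal.ofReal (C * (5 / δ) ^ n) * W) * ENNReal.ofReal (η * (C * (2 * r) ^ n)) := by
        gcongr
        exact hVlow.trans hVup'
    _ = ENNReal.ofReal (C * (5 / δ) ^ n * (η * (C * (2 * r) ^ n))) * W := by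
        rw [mul_right_comm, ← ENNReal.ofReal_mul (by positivity)]
    _ ≤ ENNReal.ofReal (ε * (β * r) ^ n) * W := by
        refine mul_le_mul_left (ENNReal.ofReal_le_ofReal ?_) _
        have h10 : (10 : ℝ) ^ n = 5 ^ n * 2 ^ n := by rw [← mul_pow]; norm_num
        have heq : C * (5 / δ) ^ n * (η * (C * (2 * r) ^ n)) =
            10 ^ n * C ^ 2 * η * (r ^ n / δ ^ n) := by
          rw [h10, div_pow, mul_pow]
          ring
        have heq' : ε * (β * r) ^ n = ε * (δ * β) ^ n * (r ^ n / δ ^ n) := by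
          rw [mul_pow, mul_pow]
          field_simp
        rw [heq, heq']
        exact mul_le_mul_of_nonneg_right hηε (by positivity)
    _ = ENNReal.ofReal ε * μH[n] (closedBall (φ x) (β * r)) := by
        have hε : 0 ≤ ε := by
          have h1 : 0 ≤ ε * (δ * β) ^ n := le_trans (by positivity) hηε
          exact nonneg_of_mul_nonneg_left h1 (by positivity)
        rw [hausdorffMeasure_closedBall (φ x) (by positivity : 0 ≤ β * r), ← mul_assoc,
          ← ENNReal.ofReal_mul hε]

/-- If the part of a ball outside a set has relative measure at most `ε`, then the part inside has
relative measure at least `1 - ε`. -/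
lemma ofReal_one_sub_mul_le_of_measure_diff_le {α : Type*} [MeasurableSpace α] {ν : Measure α}
    {B T : Set α} (hB : ν B ≠ ∞) {ε : ℝ} (hε : 0 ≤ ε)
    (h : ν (B \ T) ≤ ENNReal.ofReal ε * ν B) :
    ENNReal.ofReal (1 - ε) * ν B ≤ ν (B ∩ T) := by
  rw [ENNReal.ofReal_sub _ hε, ENNReal.ofReal_one, ENNReal.sub_mul fun _ _ => hB, one_mul,
    tsub_le_iff_right]
  exact (measure_le_inter_add_sdiff ν B T).trans (by gcongr)

/-- Almost every point of a step set satisfies the David condition at some scale. -/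
lemma measure_stepSet_diff_DCset_eq_zero {X : Type*} [MetricSpace X]
    [TopologicalSpace.SeparableSpace X] [MeasurableSpace X] [BorelSpace X]
    {n : ℕ} {μ : Measure X} [IsFiniteMeasure μ] {K : Set X} (hK : IsCompact K)
    {C RK : ℝ} (hC : 0 < C) (hRK : 0 < RK)
    (hgrowth : ∀ x ∈ K, ∀ r : ℝ, 0 < r → r < RK →
      ENNReal.ofReal (C⁻¹ * r ^ n) ≤ μ (closedBall x r) ∧
        μ (closedBall x r) ≤ ENNReal.ofReal (C * r ^ n))
    {φ : X → EuclideanSpace ℝ (Fin n)} (hφ : LipschitzWith 1 φ) {κ A H ε : ℝ}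
    (hκ : 0 < κ) (hκ1 : κ ≤ 1) (hA : 0 ≤ A) (hH : 0 < H) (hε : 0 < ε) :
    μ (stepSet K φ κ A H \ ⋃ (j : ℕ) (k : ℕ),
      DCset K φ (1 / ((j : ℝ) + 1)) ε (1 / ((k : ℝ) + 1))) = 0 := by
  set δ : ℝ := κ / (8 * (n + 1))
  have hδ : 0 < δ := by positivity
  have hδκ : δ * (8 * (n + 1)) = κ := div_mul_cancel₀ _ (by positivity)
  have hδ1 : δ < 1 := by
    have : (0 : ℝ) ≤ n := n.cast_nonneg
    nlinarith
  obtain ⟨j, hj⟩ := exists_nat_one_div_lt (div_pos hδ (by positivity : 0 < 2 + 2 * A))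
  set β : ℝ := 1 / ((j : ℝ) + 1)
  have hβ0 : 0 < β := by positivity
  have hβ : (2 + 2 * A) * β ≤ δ := by
    rw [lt_div_iff₀ (by positivity)] at hj
    linarith
  set η : ℝ := ε * (δ * β) ^ n / (10 ^ n * C ^ 2)
  have hη : 0 < η := by positivity
  have hηε : 10 ^ n * C ^ 2 * η ≤ ε * (δ * β) ^ n :=
    (mul_div_cancel₀ _ (by positivity)).le
  refine measure_mono_null ?_ (measure_nonDensityPoints_eq_zero hC hRK hgrowth
    (G := stepSet K φ κ A H) (fun y hy => hy.1) hη)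
  rintro x ⟨hxG, hxDC⟩
  refine ⟨hxG, ?_⟩
  by_contra! hcon
  obtain ⟨ρ, hρ, hdens⟩ := hcon
  refine hxDC ?_
  obtain ⟨k, hk⟩ := exists_nat_one_div_lt
    (show 0 < min (ρ / 2) (min (RK / 2) (H / (2 * β))) by positivity)
  refine mem_iUnion₂.2 ⟨j, k, hxG.1, fun r hr hrk => ?_⟩
  have hrlt := hrk.trans hk
  rw [lt_min_iff, lt_min_iff] at hrlt
  obtain ⟨hrρ, hrK, hrH⟩ := hrlt
  rw [lt_div_iff₀ (by positivity)] at hrH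
  exact ofReal_one_sub_mul_le_of_measure_diff_le (hausdorffMeasure_closedBall_ne_top _ _) hε.le
    (hausdorffMeasure_le_of_disjoint_closedBall hC hgrowth hφ hδ hδ1 hβ0 (by nlinarith) hr
      (by linarith) hη.le hηε hxG.1 (hdens (2 * r) (by linarith) (by linarith)) fun z hz =>
      exists_ball_disjoint_stepSet hK hφ hκ hA hδ hδκ hδ1 hβ hr (by linarith) hxG.1 hz.1 hz.2)

theorem david_condition_from_GP
    {X : Type*} [MetricSpace X] [CompleteSpace X] [TopologicalSpace.SeparableSpace X]
    [MeasurableSpace X] [BorelSpace X]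
    (n : ℕ) (μ : Measure X) [IsFiniteMeasure μ]
    (K : Set X) (hK : IsCompact K) (C RK : ℝ) (hC : 1 < C) (hRK : 0 < RK)
    (hgrowth : ∀ x ∈ K, ∀ r : ℝ, 0 < r → r < RK →
      ENNReal.ofReal (C⁻¹ * r ^ n) ≤ μ (closedBall x r) ∧
        μ (closedBall x r) ≤ ENNReal.ofReal (C * r ^ n))
    (φ : X → EuclideanSpace ℝ (Fin n)) (hφ : LipschitzWith 1 φ)
    (hGP : μ (K \ ⋃ (j : ℕ) (k : ℕ),
      GP K φ (1 / ((j : ℝ) + 1)) (1 / ((k : ℝ) + 1))) = 0) :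
    ∀ ε : ℝ, 0 < ε → ε < 1 →
      μ (K \ ⋃ (j : ℕ) (k : ℕ),
        DCset K φ (1 / ((j : ℝ) + 1)) ε (1 / ((k : ℝ) + 1))) = 0 := by
  intro ε hε0 _
  refine measure_mono_null (t := (K \ ⋃ (j : ℕ) (k : ℕ),
      GP K φ (1 / ((j : ℝ) + 1)) (1 / ((k : ℝ) + 1))) ∪
    ⋃ m : ℕ, (stepSet K φ (1 / ((m : ℝ) + 1)) (m + 1) (1 / ((m : ℝ) + 1)) \
      ⋃ (j : ℕ) (k : ℕ), DCset K φ (1 / ((j : ℝ) + 1)) ε (1 / ((k : ℝ) + 1)))) ?_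
    (measure_union_null hGP (measure_iUnion_null fun m =>
      measure_stepSet_diff_DCset_eq_zero hK (by linarith) hRK hgrowth hφ (by positivity)
        (div_le_one_of_le₀ (by linarith [(m.cast_nonneg : (0 : ℝ) ≤ m)]) (by positivity))
        (by positivity) (by positivity) hε0))
  rintro x ⟨hxK, hxDC⟩
  by_cases hx : x ∈ ⋃ (j : ℕ) (k : ℕ), GP K φ (1 / ((j : ℝ) + 1)) (1 / ((k : ℝ) + 1))
  · obtain ⟨j, k, hjk⟩ := mem_iUnion₂.1 hx
    obtain ⟨m, hm⟩ := mem_iUnion.1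
      (GP_subset_iUnion_stepSet hφ (by positivity) (by positivity) hjk)
    exact Or.inr (mem_iUnion.2 ⟨m, hm, hxDC⟩)
  · exact Or.inl ⟨hxK, hx⟩

end
end

section
/- For every β, ε, R > 0, the set DC(β, ε, R) is a closed subset of X. In particular, the function x ↦ H^n(φ(B(x,r) ∩ K)) is upper semicontinuous on X for each fixed r > 0. -/
open MeasureTheory Metric Set Filter ENNReal NNReal Topology

noncomputable section

/-- The images under `f` of the slices of a closed set, restricted to a compact set, have
upper semicontinuous measure. -/
theorem upperSemicontinuous_measure_image_slice {X Y Z : Type*} [TopologicalSpace X]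
    [TopologicalSpace Y] [TopologicalSpace Z] [MeasurableSpace Z] (μ : Measure Z)
    [μ.OuterRegular] {K : Set Y} (hK : IsCompact K) {D : Set (X × Y)} (hD : IsClosed D)
    {f : Y → Z} (hf : Continuous f) :
    UpperSemicontinuous fun x : X => μ (f '' {y | (x, y) ∈ D ∧ y ∈ K}) := by
  intro x c hc
  obtain ⟨U, hxU, hU, hUc⟩ := Set.exists_isOpen_lt_of_lt _ c hc
  have hfar : ∀ y ∈ K, ∀ᶠ z : X × Y in 𝓝 (x, y), z ∉ D ∨ f z.2 ∈ U := by
    intro y hy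
    by_cases hxy : (x, y) ∈ D
    · have hfy : f y ∈ U := hxU ⟨y, ⟨hxy, hy⟩, rfl⟩
      filter_upwards [(hU.preimage (hf.comp continuous_snd)).mem_nhds hfy] with z hz
      exact Or.inr hz
    · filter_upwards [hD.isOpen_compl.mem_nhds hxy] with z hz
      exact Or.inl hz
  filter_upwards [hK.eventually_forall_of_forall_eventually
    (P := fun a b => (a, b) ∉ D ∨ f b ∈ U) hfar] with x' hx'
  refine (measure_mono ?_).trans_lt hUc
  rintro _ ⟨y, ⟨hyD, hyK⟩, rfl⟩
  exact (hx' y hyK).resolve_left (not_not_intro hyD)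

instance isAddHaarMeasure_hausdorffMeasure_euclideanSpace (n : ℕ) :
    (μH[n] : Measure (EuclideanSpace ℝ (Fin n))).IsAddHaarMeasure := by
  simpa using isAddHaarMeasure_hausdorffMeasure (E := EuclideanSpace ℝ (Fin n))

theorem DCset_isClosed_and_upperSemicontinuous
    {X : Type*} [MetricSpace X] [CompleteSpace X] [TopologicalSpace.SeparableSpace X]
    (n : ℕ) (K : Set X) (hK : IsCompact K)
    (φ : X → EuclideanSpace ℝ (Fin n)) (hφ : LipschitzWith 1 φ) :
    (∀ β ε R : ℝ, 0 < β → 0 < ε → 0 < R → IsClosed (DCset K φ β ε R)) ∧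
    (∀ r : ℝ, 0 < r →
      UpperSemicontinuous fun x : X => μH[n] (φ '' (closedBall x r ∩ K))) := by
  have hφc : Continuous φ := hφ.continuous
  have hball (r : ℝ) : IsClosed {p : X × X | p.2 ∈ closedBall p.1 r} :=
    isClosed_le (continuous_snd.dist continuous_fst) continuous_const
  constructor
  · intro β ε R _ _ _
    have husc (r : ℝ) : UpperSemicontinuous fun x : X =>
        μH[n] (closedBall (φ x) (β * r) ∩ φ '' (closedBall x r ∩ K)) := by
      have hD : IsClosed {p : X × X | φ p.2 ∈ closedBall (φ p.1) (β * r)} :=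
        isClosed_le ((hφc.comp continuous_snd).dist (hφc.comp continuous_fst)) continuous_const
      convert upperSemicontinuous_measure_image_slice
        (μH[n] : Measure (EuclideanSpace ℝ (Fin n))) hK (hD.inter (hball r)) hφc using 3 with x
      ext z
      constructor
      · rintro ⟨hz, y, ⟨hy, hyK⟩, rfl⟩
        exact ⟨y, ⟨⟨hz, hy⟩, hyK⟩, rfl⟩
      · rintro ⟨y, ⟨⟨hz, hy⟩, hyK⟩, rfl⟩
        exact ⟨hz, y, ⟨hy, hyK⟩, rfl⟩
    have hDC : DCset K φ β ε R = K ∩ ⋂ (r : ℝ) (_ : 0 < r) (_ : r < R),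
        (fun x : X => μH[n] (closedBall (φ x) (β * r) ∩ φ '' (closedBall x r ∩ K))) ⁻¹'
          Ici (ENNReal.ofReal (1 - ε) *
            μH[n] (closedBall (0 : EuclideanSpace ℝ (Fin n)) (β * r))) := by
      ext x
      simp [DCset, Measure.addHaar_closedBall_center]
    rw [hDC]
    exact hK.isClosed.inter <| isClosed_iInter fun r => isClosed_iInter fun _ =>
      isClosed_iInter fun _ => (husc r).isClosed_preimage _
  · intro r _
    exact upperSemicontinuous_measure_image_slice _ hK (hball r) hφc


end
end
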